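/- Let G=(V,E,w_G) be a weighted graph and let T=(V',E',w_T) be a γ-partial tree embedding of the shortest-path metric of G. Then there exists a function ı : 2^{E'} → 2^E such that for every F' ⊆ E': (1) if u,v ∈ V' are connected by F' in T, then u and v are connected by ı(F') in G; and (2) w_G(ı(F')) ≤ w_T(F'). -/

import Mathlib

/-- An edge set `F` connects vertices `u` and `v` if they lie in the same connected
component of the graph with edge set `F`. -/
def EdgeConn {V : Type*} (F : Set (Sym2 V)) (u v : V) : Prop :=
  (SimpleGraph.fromEdgeSet F).Reachable u v

/-- A rooted weighted tree is well-separated if every child edge has weight at most half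
the weight of its parent edge. -/
def WellSeparated {V : Type*} (T : SimpleGraph V) (root : V) (w : Sym2 V → ℝ) : Prop :=
  ∀ a b c : V, T.Adj a b → T.Adj b c →
    T.dist root b = T.dist root a + 1 → T.dist root c = T.dist root b + 1 →
    w s(b, c) ≤ w s(a, b) / 2

/-- The weighted (shortest-path) distance between `u` and `v` in the weighted graph
`(T, w)`: the infimum of the total weights of walks from `u` to `v`. -/
noncomputable def wDist {α : Type*} (T : SimpleGraph α) (w : Sym2 α → ℝ) (u v : α) : ℝ :=
  sInf {x : ℝ | ∃ p : T.Walk u v, x = (p.edges.map w).sum}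

/-- A `γ`-partial tree embedding of the metric `(V, d)`. -/
structure PartialTreeEmbedding (V : Type*) (d : V → V → ℝ) (γ : ℝ) where
  verts : Set V
  tree : SimpleGraph verts
  isTree : tree.IsTree
  w' : Sym2 verts → ℝ
  root : verts
  wellSep : WellSeparated tree root w'
  dist_le_treeDist : ∀ u v : verts, d ↑u ↑v ≤ wDist tree w' u v
  treeDist_le : ∀ u v : verts, wDist tree w' u v ≤ γ * d ↑u ↑v

/-- `d` is the shortest-path metric of the weighted graph `(G, w)`. -/
def IsShortestPathMetric {V : Type*} (G : SimpleGraph V) (w : Sym2 V → ℝ)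
    (d : V → V → ℝ) : Prop :=
  ∀ u v : V, IsLeast {x : ℝ | ∃ p : G.Walk u v, x = (p.edges.map w).sum} (d u v)


theorem EdgeConn.mono {V : Type*} {F F' : Set (Sym2 V)} (h : F ⊆ F') {u v : V}
    (huv : EdgeConn F u v) : EdgeConn F' u v :=
  SimpleGraph.Reachable.mono (SimpleGraph.fromEdgeSet_mono h) huv

theorem EdgeConn.trans {V : Type*} {F : Set (Sym2 V)} {u v x : V}
    (huv : EdgeConn F u v) (hvx : EdgeConn F v x) : EdgeConn F u x :=
  SimpleGraph.Reachable.trans huv hvx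

theorem EdgeConn.symm {V : Type*} {F : Set (Sym2 V)} {u v : V}
    (huv : EdgeConn F u v) : EdgeConn F v u :=
  SimpleGraph.Reachable.symm huv

/-- If every edge of `F` joins vertices whose images are connected by `F'`, then the images of
vertices connected by `F` are connected by `F'`. -/
theorem EdgeConn.map_of_forall_edge {U V : Type*} {F : Set (Sym2 U)} {F' : Set (Sym2 V)}
    (f : U → V) (h : ∀ u v, s(u, v) ∈ F → EdgeConn F' (f u) (f v)) {u v : U}
    (huv : EdgeConn F u v) : EdgeConn F' (f u) (f v) := by
  obtain ⟨p⟩ := huv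
  induction p with
  | nil => exact SimpleGraph.Reachable.refl _
  | cons hadj _ ih => exact (h _ _ ((SimpleGraph.fromEdgeSet_adj _).1 hadj).1).trans ih

/-- The endpoints of a walk are connected by its edges. -/
theorem SimpleGraph.Walk.edgeConn_edges {V : Type*} {G : SimpleGraph V} {u v : V}
    (p : G.Walk u v) : EdgeConn {e | e ∈ p.edges} u v := by
  induction p with
  | nil => exact SimpleGraph.Reachable.refl _
  | cons hadj p ih =>
    refine EdgeConn.trans (SimpleGraph.Adj.reachable ?_) (ih.mono ?_)
    · simp [hadj.ne]
    · intro e he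
      simp_all

theorem List.sum_toFinset_le_sum_map {α : Type*} [DecidableEq α] (f : α → ℝ) (l : List α)
    (h : ∀ a ∈ l, 0 ≤ f a) : ∑ a ∈ l.toFinset, f a ≤ (l.map f).sum := by
  induction l with
  | nil => simp
  | cons a l ih =>
    have ih' := ih fun b hb => h b (by simp [hb])
    have ha := h a (by simp)
    by_cases hal : a ∈ l
    · simp only [List.toFinset_cons, List.mem_toFinset, hal, Finset.insert_eq_of_mem,
        List.map_cons, List.sum_cons]
      linarith
    · rw [List.toFinset_cons, Finset.sum_insert (by simpa using hal), List.map_cons,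
        List.sum_cons]
      linarith

theorem Finset.sum_biUnion_le_sum {α β : Type*} [DecidableEq α] [DecidableEq β] (s : Finset α)
    (t : α → Finset β) (f : β → ℝ) (h : ∀ a ∈ s, ∀ b ∈ t a, 0 ≤ f b) :
    ∑ b ∈ s.biUnion t, f b ≤ ∑ a ∈ s, ∑ b ∈ t a, f b := by
  induction s using Finset.induction_on with
  | empty => simp
  | insert a s ha ih =>
    rw [Finset.biUnion_insert, Finset.sum_insert ha]
    have ih' := ih fun c hc => h c (Finset.mem_insert_of_mem hc)
    have hunion := Finset.sum_union_inter (s₁ := t a) (s₂ := s.biUnion t) (f := f)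
    have hinter : 0 ≤ ∑ b ∈ t a ∩ s.biUnion t, f b := Finset.sum_nonneg fun b hb =>
      h a (Finset.mem_insert_self a s) b (Finset.mem_inter.1 hb).1
    linarith

theorem IsShortestPathMetric.one_le {V : Type*} {G : SimpleGraph V} {w : Sym2 V → ℝ}
    {d : V → V → ℝ} (hd : IsShortestPathMetric G w d) (hw : ∀ e ∈ G.edgeSet, 1 ≤ w e)
    {u v : V} (huv : u ≠ v) : 1 ≤ d u v := by
  obtain ⟨p, hp⟩ := (hd u v).1
  rw [hp]
  cases p with
  | nil => exact absurd rfl huv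
  | cons hadj q =>
    have hq : 0 ≤ (q.edges.map w).sum := List.sum_nonneg <| by
      simp only [List.mem_map, forall_exists_index, and_imp, forall_apply_eq_imp_iff₂]
      exact fun e he => zero_le_one.trans (hw e (q.edges_subset_edgeSet he))
    have he := hw _ ((SimpleGraph.mem_edgeSet G).2 hadj)
    simp only [SimpleGraph.Walk.edges_cons, List.map_cons, List.sum_cons]
    linarith

/-- A tree edge is at least as heavy as the distance between its endpoints. -/
theorem PartialTreeEmbedding.dist_le_weight {V : Type*} {d : V → V → ℝ} {γ : ℝ}
    (emb : PartialTreeEmbedding V d γ) {u v : emb.verts} (hd : 0 < d u v)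
    (h : emb.tree.Adj u v) : d u v ≤ emb.w' s(u, v) := by
  have hle := emb.dist_le_treeDist u v
  unfold wDist at hle
  by_cases hb : BddBelow {x : ℝ | ∃ p : emb.tree.Walk u v, x = (p.edges.map emb.w').sum}
  · exact hle.trans (csInf_le hb ⟨h.toWalk, by simp⟩)
  · rw [Real.sInf_of_not_bddBelow hb] at hle
    exact absurd hd hle.not_gt

/-- partial tree → graph projection.  If `T` is a `γ`-partial tree
embedding of the shortest-path metric of a weighted graph `G`, then there is a map
`ı : 2^{E'} → 2^E` such that for every `F' ⊆ E'`: vertices of `T` connected by `F'` in `T`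
are connected by `ı(F')` in `G`, and `w_G(ı(F')) ≤ w_T(F')`. -/
theorem partialTree_to_graph_projection {V : Type} [Fintype V] (G : SimpleGraph V)
    (w : Sym2 V → ℝ) (hG : G.Connected) (hw : ∀ e ∈ G.edgeSet, 1 ≤ w e)
    (d : V → V → ℝ) (hd : IsShortestPathMetric G w d)
    (γ : ℝ) (emb : PartialTreeEmbedding V d γ) :
    ∃ ι : Finset (Sym2 emb.verts) → Finset (Sym2 V),
      ∀ F' : Finset (Sym2 emb.verts), ↑F' ⊆ emb.tree.edgeSet →
        (↑(ι F') ⊆ G.edgeSet) ∧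
        (∀ u v : emb.verts, EdgeConn (↑F') u v →
          EdgeConn (↑(ι F')) (↑u : V) (↑v : V)) ∧
        ∑ e ∈ ι F', w e ≤ ∑ e ∈ F', emb.w' e := by
  classical
  have hnn : ∀ e ∈ G.edgeSet, 0 ≤ w e := fun e he => zero_le_one.trans (hw e he)
  have key : ∀ e : Sym2 emb.verts, e ∈ emb.tree.edgeSet → ∃ S : Finset (Sym2 V),
      (↑S ⊆ G.edgeSet) ∧ (∀ u v : emb.verts, s(u, v) = e → EdgeConn (↑S) (↑u : V) (↑v : V)) ∧
        ∑ b ∈ S, w b ≤ emb.w' e := by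
    intro e
    induction e with
    | _ x y =>
      intro hxy
      have hadj : emb.tree.Adj x y := hxy
      obtain ⟨p, hp⟩ := (hd x y).1
      have hpS : EdgeConn (↑p.edges.toFinset) (x : V) (y : V) :=
        p.edgeConn_edges.mono fun e he => by simpa using he
      refine ⟨p.edges.toFinset, fun e he => p.edges_subset_edgeSet (by simpa using he), ?_, ?_⟩
      · intro u v huv
        rcases Sym2.eq_iff.1 huv with ⟨rfl, rfl⟩ | ⟨rfl, rfl⟩
        · exact hpS
        · exact hpS.symm
      · have hpos : 0 < d x y :=
          zero_lt_one.trans_le (hd.one_le hw (Subtype.coe_injective.ne hadj.ne))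
        calc ∑ b ∈ p.edges.toFinset, w b ≤ (p.edges.map w).sum :=
              List.sum_toFinset_le_sum_map w _ fun e he => hnn e (p.edges_subset_edgeSet he)
          _ = d x y := hp.symm
          _ ≤ emb.w' s(x, y) := emb.dist_le_weight hpos hadj
  choose! S hSG hSconn hSw using key
  refine ⟨fun F' => F'.biUnion S, fun F' hF' => ⟨?_, ?_, ?_⟩⟩
  · intro b hb
    obtain ⟨e, he, hbe⟩ := Finset.mem_biUnion.1 hb
    exact hSG e (hF' he) hbe
  · intro u v huv
    refine huv.map_of_forall_edge Subtype.val fun x y hxy => ?_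
    exact (hSconn _ (hF' hxy) x y rfl).mono
      (Finset.coe_subset.2 (Finset.subset_biUnion_of_mem S hxy))
  · exact (Finset.sum_biUnion_le_sum F' S w fun e he b hb => hnn b (hSG e (hF' he) hb)).trans
      (Finset.sum_le_sum fun e he => hSw e (hF' he))
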